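/- Let a, b ∈ Homeo₊(S¹) have ping-pong dynamics with connected attracting domains (closed arcs) D(a), D(a⁻¹), D(b), D(b⁻¹) occurring in this counterclockwise cyclic order on S¹, i.e., ord(p,q,r) = 1 and ord(p,r,s) = 1 for all p ∈ D(a), q ∈ D(a⁻¹), r ∈ D(b), s ∈ D(b⁻¹). Let ρ : F₂ → Homeo₊(S¹) be the homomorphism from the free group on two generators sending the generators to a and b. Then for no point x₀ ∈ S¹ and no circular order c on F₂ is ρ a dynamical realization of c with basepoint x₀. -/

import Mathlib

noncomputable section

open Classical in
/-- The circle `ℝ/ℤ`. -/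
abbrev S1 : Type := AddCircle (1 : ℝ)

/-- The canonical representative of a point of the circle in `[0,1)`. -/
noncomputable def S1.rep (x : S1) : ℝ := (AddCircle.equivIco 1 0 x : ℝ)

open Classical in
/-- The orientation cocycle on the circle: `1` on positively oriented (counterclockwise)
triples of pairwise distinct points, `-1` on negatively oriented ones, `0` otherwise. -/
noncomputable def circOrd (x y z : S1) : ℤ :=
  if x = y ∨ y = z ∨ x = z then 0
  else if (S1.rep x < S1.rep y ∧ S1.rep y < S1.rep z) ∨
      (S1.rep y < S1.rep z ∧ S1.rep z < S1.rep x) ∨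
      (S1.rep z < S1.rep x ∧ S1.rep x < S1.rep y) then 1 else -1

/-- The group `Homeo₊(S¹)` of orientation preserving homeomorphisms of the circle, realized
as the subgroup of bijections of `S¹` which are homeomorphisms and preserve the orientation
cocycle. -/
noncomputable def HomeoPos : Subgroup (Equiv.Perm S1) where
  carrier := {f | Continuous f ∧ Continuous f.symm ∧
    ∀ x y z, circOrd (f x) (f y) (f z) = circOrd x y z}
  one_mem' := ⟨by simpa using continuous_id, by exact continuous_id, by simp⟩
  mul_mem' := by
    rintro a b ⟨ha1, ha2, ha3⟩ ⟨hb1, hb2, hb3⟩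
    refine ⟨?_, ?_, ?_⟩
    · have : ⇑(a * b) = ⇑a ∘ ⇑b := by ext x; simp [Equiv.Perm.mul_apply]
      rw [this]; exact ha1.comp hb1
    · have : ⇑(a * b).symm = ⇑b.symm ∘ ⇑a.symm := by
        ext x; rfl
      rw [this]; exact hb2.comp ha2
    · intro x y z
      simp only [Equiv.Perm.mul_apply]
      rw [ha3, hb3]
  inv_mem' := by
    rintro a ⟨ha1, ha2, ha3⟩
    refine ⟨ha2, by exact ha1, ?_⟩
    intro x y z
    have := ha3 (a⁻¹ x) (a⁻¹ y) (a⁻¹ z)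
    simpa using this.symm

/-- The action of an element of `Homeo₊(S¹)` on the circle. -/
def ap (h : ↥HomeoPos) (x : S1) : S1 := h.1 x

lemma ap_one (x : S1) : ap 1 x = x := rfl

lemma ap_mul (h₁ h₂ : ↥HomeoPos) (x : S1) : ap (h₁ * h₂) x = ap h₁ (ap h₂ x) := rfl

variable {G : Type*} [Group G]

/-- A (left-invariant) circular order on a group `G`: a function `G³ → {-1,0,1}` vanishing
exactly on degenerate triples, satisfying the cocycle identity, and left-invariant. -/
def IsCircularOrder (c : G → G → G → ℤ) : Prop :=
  (∀ a b d, c a b d = 0 ↔ a = b ∨ b = d ∨ a = d) ∧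
  (∀ a b d, c a b d = 1 ∨ c a b d = 0 ∨ c a b d = -1) ∧
  (∀ g₁ g₂ g₃ g₄, c g₂ g₃ g₄ - c g₁ g₃ g₄ + c g₁ g₂ g₄ - c g₁ g₂ g₃ = 0) ∧
  (∀ g u v w, c (g * u) (g * v) (g * w) = c u v w)

/-- `c` is an isolated point of the space `CO(G)` of circular orders on `G` (with the
topology induced from the product topology on `{-1,0,1}^{G³}`): some basic neighborhood,
determined by agreement on a finite subset of `G`, contains only `c`. -/
def IsIsolatedCO (c : G → G → G → ℤ) : Prop :=
  ∃ S : Finset G, ∀ c' : G → G → G → ℤ, IsCircularOrder c' →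
    (∀ u ∈ S, ∀ v ∈ S, ∀ w ∈ S, c' u v w = c u v w) → c' = c

/-- The basepoint `x₀` has trivial stabilizer under the action `ρ`. -/
def TrivialStabilizer (ρ : G →* ↥HomeoPos) (x₀ : S1) : Prop :=
  ∀ g : G, ap (ρ g) x₀ = x₀ → g = 1

/-- The circular order on `G` induced by the orbit of a point `x₀` with trivial stabilizer. -/
def inducedCO (ρ : G →* ↥HomeoPos) (x₀ : S1) (g₁ g₂ g₃ : G) : ℤ :=
  circOrd (ap (ρ g₁) x₀) (ap (ρ g₂) x₀) (ap (ρ g₃) x₀)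

/-- A continuous degree-one monotone map of the circle: a continuous surjection which
weakly preserves the orientation cocycle. -/
def DegOneMonotone (f : S1 → S1) : Prop :=
  Continuous f ∧ Function.Surjective f ∧
    ∀ x y z, f x ≠ f y → f y ≠ f z → f x ≠ f z → circOrd (f x) (f y) (f z) = circOrd x y z

/-- `ρ` is a dynamical realization of the circular order `c` with basepoint `x₀`. -/
def IsDynamicalRealization (ρ : G →* ↥HomeoPos) (x₀ : S1) (c : G → G → G → ℤ) : Prop :=
  TrivialStabilizer ρ x₀ ∧
  (∀ g₁ g₂ g₃, inducedCO ρ x₀ g₁ g₂ g₃ = c g₁ g₂ g₃) ∧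
  ∀ ρ' : G →* ↥HomeoPos, TrivialStabilizer ρ' x₀ →
    (∀ g₁ g₂ g₃, inducedCO ρ' x₀ g₁ g₂ g₃ = c g₁ g₂ g₃) →
    ∃ f : S1 → S1, DegOneMonotone f ∧ f x₀ = x₀ ∧
      ∀ g : G, (ap (ρ g)) ∘ f = f ∘ (ap (ρ' g))

end
noncomputable section

/-- cyclic order of reals -/
def Cyc (x y z : ℝ) : Prop := (x < y ∧ y < z) ∨ (y < z ∧ z < x) ∨ (z < x ∧ x < y)

lemma rep_inj {x y : S1} (h : S1.rep x = S1.rep y) : x = y :=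
  (AddCircle.equivIco 1 0).injective (Subtype.ext h)

lemma rep_nonneg (x : S1) : 0 ≤ S1.rep x := (AddCircle.equivIco 1 0 x).2.1

lemma rep_lt (x : S1) : S1.rep x < 1 := by
  have := (AddCircle.equivIco 1 0 x).2.2
  simpa [S1.rep] using this

lemma coe_rep (x : S1) : ((S1.rep x : ℝ) : S1) = x :=
  (AddCircle.equivIco 1 0).symm_apply_apply x

lemma rep_coe {x : ℝ} (h0 : 0 ≤ x) (h1 : x < 1) : S1.rep (x : S1) = x := by
  have : (AddCircle.equivIco 1 0) ((⟨x, h0, by simpa using h1⟩ : Set.Ico (0:ℝ) (0+1)) : ℝ) =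
      (⟨x, h0, by simpa using h1⟩ : Set.Ico (0:ℝ) (0+1)) :=
    (AddCircle.equivIco 1 0).apply_symm_apply _
  unfold S1.rep
  rw [this]

lemma co_iff (x y z : S1) : circOrd x y z = 1 ↔ Cyc (S1.rep x) (S1.rep y) (S1.rep z) := by
  unfold circOrd Cyc
  split_ifs with h1 h2
  · constructor
    · intro h; norm_num at h
    · rcases h1 with h | h | h <;> subst h <;> intro h <;> exfalso <;> grind
  · simpa using h2
  · constructor
    · intro h; norm_num at h
    · intro h; exact absurd h h2

lemma co_zero (x y z : S1) : circOrd x y z = 0 ↔ x = y ∨ y = z ∨ x = z := by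
  unfold circOrd
  split_ifs with h1 h2 <;> simp [h1]

lemma co_vals (x y z : S1) : circOrd x y z = 0 ∨ circOrd x y z = 1 ∨ circOrd x y z = -1 := by
  unfold circOrd
  split_ifs with h1 h2 <;> simp

/-- two triples have the same orientation -/
lemma co_eq {x y z x' y' z' : S1} (h0 : (x = y ∨ y = z ∨ x = z) ↔ (x' = y' ∨ y' = z' ∨ x' = z'))
    (h1 : circOrd x y z = 1 ↔ circOrd x' y' z' = 1) : circOrd x y z = circOrd x' y' z' := by
  rw [← co_zero, ← co_zero] at h0
  have := co_vals x y z
  have := co_vals x' y' z'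
  omega

lemma co_rot (x y z : S1) : circOrd x y z = circOrd y z x := by
  apply co_eq
  · grind
  · simp only [co_iff, Cyc]; grind

lemma co_ne {x y z : S1} (h : circOrd x y z = 1) : x ≠ y ∧ y ≠ z ∧ x ≠ z := by
  have := co_zero x y z
  grind

/-- transitivity -/
lemma co_trans {p q r s : S1} (h1 : circOrd p q r = 1) (h2 : circOrd p r s = 1) :
    circOrd p q s = 1 ∧ circOrd q r s = 1 := by
  simp only [co_iff, Cyc] at *; grind

lemma arc_open (p q : S1) : IsOpen {w : S1 | circOrd p w q = 1} := by
  have hO : IsOpenMap ((↑) : ℝ → S1) := QuotientAddGroup.isOpenMap_coe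
  have key : {w : S1 | circOrd p w q = 1} =
      ((↑) : ℝ → S1) '' (if S1.rep p < S1.rep q then Set.Ioo (S1.rep p) (S1.rep q) else
        if S1.rep q < S1.rep p then Set.Ioo (S1.rep p) (S1.rep q + 1) else ∅) := by
    have hp0 := rep_nonneg p
    have hq0 := rep_nonneg q
    have hp1 := rep_lt p
    have hq1 := rep_lt q
    ext w
    simp only [Set.mem_ofPred_eq, Set.mem_image]
    rw [co_iff]
    have hw0 := rep_nonneg w
    have hw1 := rep_lt w
    split_ifs with h1 h2
    · constructor
      · intro h
        exact ⟨S1.rep w, by simp only [Cyc] at h; simp only [Set.mem_Ioo]; grind, coe_rep w⟩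
      · rintro ⟨x, hx, rfl⟩
        rw [rep_coe (by linarith [hx.1]) (by linarith [hx.2])]
        exact Or.inl hx
    · constructor
      · intro h
        by_cases hw : S1.rep p < S1.rep w
        · exact ⟨S1.rep w, ⟨hw, by linarith⟩, coe_rep w⟩
        · refine ⟨S1.rep w + 1, ⟨by linarith, ?_⟩, ?_⟩
          · simp only [Cyc] at h; grind
          · rw [AddCircle.coe_add, coe_rep, AddCircle.coe_period, add_zero]
      · rintro ⟨x, hx, rfl⟩
        by_cases hx1 : x < 1
        · rw [rep_coe (by linarith [hx.1]) hx1]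
          exact Or.inr (Or.inr ⟨h2, hx.1⟩)
        · have : ((x : ℝ) : S1) = ((x - 1 : ℝ) : S1) := by
            rw [AddCircle.coe_sub, AddCircle.coe_period, sub_zero]
          rw [this, rep_coe (by linarith) (by linarith [hx.2])]
          exact Or.inr (Or.inl ⟨by linarith [hx.2], h2⟩)
    · simp only [Cyc, Set.mem_empty_iff_false, false_and, exists_false, iff_false]
      grind
  rw [key]
  apply hO
  split_ifs
  · exact isOpen_Ioo
  · exact isOpen_Ioo
  · exact isOpen_empty

/-- coordinate with base point o -/
def rr (o x : S1) : ℝ := if S1.rep x < S1.rep o then S1.rep x + 1 else S1.rep x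

lemma coe_rr (o x : S1) : ((rr o x : ℝ) : S1) = x := by
  unfold rr
  split_ifs
  · rw [AddCircle.coe_add, coe_rep, AddCircle.coe_period, add_zero]
  · exact coe_rep x

lemma rr_lo (o x : S1) : 0 ≤ rr o x := by
  have := rep_nonneg x
  unfold rr; split_ifs <;> linarith

lemma rr_hi (o x : S1) : rr o x ≤ 2 := by
  have := rep_lt x
  unfold rr; split_ifs <;> linarith

lemma rr_lt {o x y : S1} (h : circOrd o x y = 1) : rr o x < rr o y := by
  have := rep_lt x
  have := rep_lt y
  have := rep_nonneg x
  have := rep_nonneg y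
  rw [co_iff] at h
  unfold Cyc at h
  unfold rr
  split_ifs <;> grind

lemma conv_of_mono (o : S1) (x : ℕ → S1)
    (h : (∀ n, circOrd o (x n) (x (n+1)) = 1) ∨ (∀ n, circOrd o (x (n+1)) (x n) = 1)) :
    ∃ p, Filter.Tendsto x Filter.atTop (nhds p) := by
  have hc : ∃ P : ℝ, Filter.Tendsto (fun n => rr o (x n)) Filter.atTop (nhds P) := by
    rcases h with h | h
    · exact ⟨_, tendsto_atTop_ciSup (monotone_nat_of_le_succ fun n => (rr_lt (h n)).le)
        ⟨2, by rintro _ ⟨n, rfl⟩; exact rr_hi _ _⟩⟩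
    · exact ⟨_, tendsto_atTop_ciInf (antitone_nat_of_succ_le fun n => (rr_lt (h n)).le)
        ⟨0, by rintro _ ⟨n, rfl⟩; exact rr_lo _ _⟩⟩
  obtain ⟨P, hP⟩ := hc
  refine ⟨(P : S1), ?_⟩
  have hcont : Continuous ((↑) : ℝ → S1) := continuous_quotient_mk'
  have := (hcont.tendsto P).comp hP
  refine this.congr fun n => ?_
  simp [coe_rr]

lemma ap_cont (t : ↥HomeoPos) : Continuous (ap t) := t.2.1

lemma ap_co (t : ↥HomeoPos) (x y z : S1) :
    circOrd (ap t x) (ap t y) (ap t z) = circOrd x y z := t.2.2.2 x y z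

lemma ap_inv_ap (t : ↥HomeoPos) (x : S1) : ap t⁻¹ (ap t x) = x := by
  rw [← ap_mul, inv_mul_cancel, ap_one]

lemma ap_ap_inv (t : ↥HomeoPos) (x : S1) : ap t (ap t⁻¹ x) = x := by
  rw [← ap_mul, mul_inv_cancel, ap_one]

lemma lim_fix (t : ↥HomeoPos) (D : Set S1) (hD : IsClosed D) (o : S1)
    (hin : ∀ n : ℕ, ap (t ^ (n+1)) o ∈ D)
    (h : (∀ n : ℕ, circOrd o (ap (t ^ (n+1)) o) (ap (t ^ (n+2)) o) = 1) ∨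
      (∀ n : ℕ, circOrd o (ap (t ^ (n+2)) o) (ap (t ^ (n+1)) o) = 1)) :
    ∃ p ∈ D, ap t p = p ∧ p ∈ closure (Set.range fun n : ℕ => ap (t ^ n) o) := by
  obtain ⟨p, hp⟩ := conv_of_mono o (fun n => ap (t ^ (n+1)) o) h
  refine ⟨p, hD.mem_of_tendsto hp (Filter.Eventually.of_forall hin), ?_, ?_⟩
  · have h1 := ((ap_cont t).tendsto p).comp hp
    have h2 := (Filter.tendsto_add_atTop_iff_nat 1).2 hp
    refine tendsto_nhds_unique h1 (h2.congr fun n => ?_)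
    simp only [Function.comp]
    rw [← ap_mul, ← pow_succ']
  · exact mem_closure_of_tendsto hp (Filter.Eventually.of_forall fun n => ⟨n+1, rfl⟩)

lemma pow_in (t : ↥HomeoPos) (D D' : Set S1) (hd : Disjoint D D')
    (hpp : (ap t) '' (Set.univ \ D') ⊆ D) (o : S1) (ho : o ∉ D') (n : ℕ) :
    ap (t ^ (n+1)) o ∈ D := by
  induction n with
  | zero => exact hpp ⟨o, ⟨trivial, ho⟩, by simp⟩
  | succ n ih =>
    rw [pow_succ', ap_mul]
    exact hpp ⟨_, ⟨trivial, Set.disjoint_left.1 hd ih⟩, rfl⟩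

lemma exists_fix (t : ↥HomeoPos) (D D' : Set S1) (hD : IsClosed D) (hD' : IsClosed D')
    (hne : D.Nonempty) (hne' : D'.Nonempty)
    (hd : Disjoint D D')
    (hpp : (ap t) '' (Set.univ \ D') ⊆ D ∧ (ap t⁻¹) '' (Set.univ \ D) ⊆ D')
    (o : S1) (ho : ∀ p ∈ D, ∀ q ∈ D', circOrd p q o = 1) :
    ∃ p ∈ D, ∃ q ∈ D', ap t p = p ∧ ap t q = q ∧
      p ∈ closure (Set.range fun n : ℕ => ap (t ^ n) o) ∧
      q ∈ closure (Set.range fun n : ℕ => ap (t⁻¹ ^ n) o) := by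
  have hoD : o ∉ D := fun h => by
    obtain ⟨q, hq⟩ := hne'
    exact (co_ne (ho o h q hq)).2.2 rfl
  have hoD' : o ∉ D' := fun h => by
    obtain ⟨p, hp⟩ := hne
    exact (co_ne (ho p hp o h)).2.1 rfl
  have hin := pow_in t D D' hd hpp.1 o hoD'
  have hin' := pow_in t⁻¹ D' D hd.symm hpp.2 o hoD
  have h1 : ap t o ∈ D := by simpa using hin 0
  have h1' : ap t⁻¹ o ∈ D' := by simpa using hin' 0
  have base : circOrd (ap t⁻¹ o) o (ap t o) = 1 := by
    rw [← co_rot]; exact ho _ h1 _ h1'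
  obtain ⟨p, hp, hp1, hp2⟩ := lim_fix t D hD o hin (Or.inl (fun n => by
    induction n with
    | zero =>
      rw [← base, ← ap_co t (ap t⁻¹ o), ap_ap_inv]
      simp [pow_succ', ap_mul]
    | succ n ih =>
      have e : circOrd o (ap (t ^ (n+1+1)) o) (ap (t ^ (n+1+2)) o) =
          circOrd (ap t⁻¹ o) (ap (t ^ (n+1)) o) (ap (t ^ (n+2)) o) := by
        rw [← ap_co t (ap t⁻¹ o), ap_ap_inv, ← ap_mul, ← ap_mul, ← pow_succ', ← pow_succ']
      rw [e]
      have a1 := ho _ (hin n) _ h1'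
      have a2 := ho _ (hin (n+1)) _ h1'
      simp only [co_iff, Cyc] at *; grind))
  obtain ⟨q, hq, hq1, hq2⟩ := lim_fix t⁻¹ D' hD' o hin' (Or.inr (fun n => by
    induction n with
    | zero =>
      rw [← base, ← ap_co t⁻¹ _ _ (ap t o), ap_inv_ap, co_rot]
      simp [pow_succ', ap_mul, ap_one]
    | succ n ih =>
      have e : circOrd o (ap (t⁻¹ ^ (n+1+2)) o) (ap (t⁻¹ ^ (n+1+1)) o) =
          circOrd (ap t o) (ap (t⁻¹ ^ (n+2)) o) (ap (t⁻¹ ^ (n+1)) o)  := by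
        rw [← ap_co t⁻¹ (ap t o), ap_inv_ap, ← ap_mul, ← ap_mul, ← pow_succ', ← pow_succ']
      rw [e]
      have a1 := ho _ h1 _ (hin' n)
      have a2 := ho _ h1 _ (hin' (n+1))
      simp only [co_iff, Cyc] at *; grind))
  refine ⟨p, hp, q, hq, hp1, ?_, hp2, hq2⟩
  conv_lhs => rw [← hq1]
  exact ap_ap_inv t q

/-- there is a moved point in the arc -/
lemma exists_moved (t : ↥HomeoPos) (D D' : Set S1) (hD : IsClosed D) (hD' : IsClosed D')
    (hd : Disjoint D D')
    (hpp : (ap t) '' (Set.univ \ D') ⊆ D) (p q : S1) (hp : p ∈ D) (hq : q ∈ D') :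
    ∃ z, circOrd p z q = 1 ∧ ap t z ≠ z := by
  by_contra hcon
  push Not at hcon
  have hsub : ∀ z, circOrd p z q = 1 → z ∈ D ∪ D' := by
    intro z hz
    by_contra hz'
    have : z ∉ D' := fun h => hz' (Or.inr h)
    have h2 : ap t z ∈ D := hpp ⟨z, ⟨trivial, this⟩, rfl⟩
    rw [hcon z hz] at h2
    exact hz' (Or.inl h2)
  have hpq : p ≠ q := fun h => Set.disjoint_left.1 hd hp (h ▸ hq)
  have hcont : Continuous ((↑) : ℝ → S1) := continuous_quotient_mk'
  -- the arc as the image of a segment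
  obtain ⟨P, Q, hPQ, hP, hQ, himg⟩ : ∃ P Q : ℝ, P ≤ Q ∧ (P : S1) = p ∧ (Q : S1) = q ∧
      ∀ x, P < x → x < Q → circOrd p (x : S1) q = 1 := by
    have hp0 := rep_nonneg p
    have hq0 := rep_nonneg q
    have hp1 := rep_lt p
    have hq1 := rep_lt q
    have hne : S1.rep p ≠ S1.rep q := fun h => hpq (rep_inj h)
    rcases lt_or_gt_of_ne hne with h | h
    · refine ⟨_, _, h.le, coe_rep p, coe_rep q, fun x h1 h2 => ?_⟩
      rw [co_iff, rep_coe (by linarith) (by linarith)]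
      exact Or.inl ⟨h1, h2⟩
    · refine ⟨S1.rep p, S1.rep q + 1, by linarith, coe_rep p, ?_, fun x h1 h2 => ?_⟩
      · rw [AddCircle.coe_add, coe_rep, AddCircle.coe_period, add_zero]
      · rw [co_iff]
        by_cases hx1 : x < 1
        · rw [rep_coe (by linarith) hx1]
          exact Or.inr (Or.inr ⟨h, h1⟩)
        · have : ((x : ℝ) : S1) = ((x - 1 : ℝ) : S1) := by
            rw [AddCircle.coe_sub, AddCircle.coe_period, sub_zero]
          rw [this, rep_coe (by linarith) (by linarith)]
          exact Or.inr (Or.inl ⟨by linarith, h⟩)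
  have := isPreconnected_closed_iff.1 (isPreconnected_Icc (a := P) (b := Q))
    (((↑) : ℝ → S1) ⁻¹' D) (((↑) : ℝ → S1) ⁻¹' D') (hD.preimage hcont) (hD'.preimage hcont)
    (by
      rintro x ⟨h1, h2⟩
      rcases h1.eq_or_lt with h1 | h1
      · left; subst h1; change (P : S1) ∈ D; rwa [hP]
      rcases h2.eq_or_lt with h2 | h2
      · right; subst h2; change ((x : ℝ) : S1) ∈ D'; rwa [hQ]
      exact hsub _ (himg x h1 h2))
    ⟨P, ⟨le_rfl, hPQ⟩, by change (P : S1) ∈ D; rwa [hP]⟩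
    ⟨Q, ⟨hPQ, le_rfl⟩, by change (Q : S1) ∈ D'; rwa [hQ]⟩
  obtain ⟨x, -, hx1, hx2⟩ := this
  exact Set.disjoint_left.1 hd hx1 hx2

section modify

open Classical in
/-- modified map -/
def modFun (t : ↥HomeoPos) (p q : S1) (x : S1) : S1 := if circOrd p x q = 1 then x else ap t x

lemma arc_inv (t : ↥HomeoPos) {p q : S1} (hp : ap t p = p) (hq : ap t q = q) (x : S1) :
    circOrd p (ap t x) q = circOrd p x q := by
  conv_lhs => rw [← hp, ← hq]
  exact ap_co t p x q

lemma fix_inv (t : ↥HomeoPos) {p : S1} (hp : ap t p = p) : ap t⁻¹ p = p := by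
  conv_lhs => rw [← hp]
  exact ap_inv_ap t p

lemma modFun_cont (t : ↥HomeoPos) {p q : S1} (hpq : p ≠ q)
    (hp : ap t p = p) (hq : ap t q = q) :
    Continuous (modFun t p q) := by
  unfold modFun
  apply Continuous.if
  · intro x hx
    have h1 : x ∉ {w | circOrd p w q = 1} := by
      intro h
      rw [(arc_open p q).frontier_eq] at hx
      exact hx.2 h
    have h2 : x ∉ {w | circOrd q w p = 1} := by
      intro h
      have hx' := frontier_subset_closure hx
      rw [mem_closure_iff] at hx'
      obtain ⟨y, hy1, hy2⟩ := hx' _ (arc_open q p) h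
      simp only [Set.mem_ofPred_eq, co_iff, Cyc] at hy1 hy2
      grind
    have h3 : x = p ∨ x = q := by
      simp only [Set.mem_ofPred_eq, co_iff, Cyc] at h1 h2
      by_contra hcon
      push Not at hcon
      have a1 : S1.rep x ≠ S1.rep p := fun h => hcon.1 (rep_inj h)
      have a2 : S1.rep x ≠ S1.rep q := fun h => hcon.2 (rep_inj h)
      have a3 : S1.rep p ≠ S1.rep q := fun h => hpq (rep_inj h)
      grind
    rcases h3 with rfl | rfl
    · exact hp.symm
    · exact hq.symm
  · exact continuous_id
  · exact ap_cont t

lemma modFun_left (t : ↥HomeoPos) {p q : S1}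
    (hp : ap t p = p) (hq : ap t q = q) (x : S1) : modFun t⁻¹ p q (modFun t p q x) = x := by
  unfold modFun
  by_cases h : circOrd p x q = 1
  · simp [h]
  · have h' : ¬ circOrd p (ap t x) q = 1 := by rwa [arc_inv t hp hq]
    simp [h, h', ap_inv_ap]

lemma L1 {p q u v w w' : S1} (hw : circOrd p w q = 1) (hw' : circOrd p w' q = 1)
    (hu : ¬ circOrd p u q = 1) (hv : ¬ circOrd p v q = 1) :
    circOrd w u v = circOrd w' u v := by
  apply co_eq
  · have : w ≠ u := fun h => hu (h ▸ hw)
    have : w ≠ v := fun h => hv (h ▸ hw)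
    have : w' ≠ u := fun h => hu (h ▸ hw')
    have : w' ≠ v := fun h => hv (h ▸ hw')
    grind
  · simp only [co_iff, Cyc] at *; grind

lemma L2 {p q u v w w' : S1} (hw : circOrd p w q = 1) (hw' : circOrd p w' q = 1)
    (hu : ¬ circOrd p u q = 1) (hv : ¬ circOrd p v q = 1) :
    circOrd u w w' = circOrd v w w' := by
  apply co_eq
  · have : w ≠ u := fun h => hu (h ▸ hw)
    have : w ≠ v := fun h => hv (h ▸ hw)
    have : w' ≠ u := fun h => hu (h ▸ hw')
    have : w' ≠ v := fun h => hv (h ▸ hw')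
    grind
  · simp only [co_iff, Cyc] at *; grind

lemma modFun_co (t : ↥HomeoPos) {p q : S1}
    (hp : ap t p = p) (hq : ap t q = q) (x y z : S1) :
    circOrd (modFun t p q x) (modFun t p q y) (modFun t p q z) = circOrd x y z := by
  have one : ∀ x y z, circOrd p x q = 1 → ¬ circOrd p y q = 1 → ¬ circOrd p z q = 1 →
      circOrd x (ap t y) (ap t z) = circOrd x y z := by
    intro x y z hx hy hz
    rw [← ap_co t x y z]
    exact L1 hx (by rwa [arc_inv t hp hq]) (by rwa [arc_inv t hp hq]) (by rwa [arc_inv t hp hq])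
  have two : ∀ x y z, ¬ circOrd p x q = 1 → circOrd p y q = 1 → circOrd p z q = 1 →
      circOrd (ap t x) y z = circOrd x y z := by
    intro x y z hx hy hz
    exact L2 hy hz (by rwa [arc_inv t hp hq]) hx
  unfold modFun
  by_cases hx : circOrd p x q = 1 <;> by_cases hy : circOrd p y q = 1 <;>
    by_cases hz : circOrd p z q = 1 <;> simp only [hx, hy, hz, if_true, if_false]
  · rw [← co_rot, two z x y hz hx hy, co_rot]
  · rw [co_rot, two y z x hy hz hx, ← co_rot]
  · exact one x y z hx hy hz
  · exact two x y z hx hy hz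
  · rw [co_rot, one y z x hy hz hx, ← co_rot]
  · rw [← co_rot, one z x y hz hx hy, co_rot]
  · exact ap_co t x y z

/-- modified homeomorphism -/
def modHomeo (t : ↥HomeoPos) {p q : S1} (hpq : p ≠ q)
    (hp : ap t p = p) (hq : ap t q = q) : ↥HomeoPos :=
  ⟨{ toFun := modFun t p q
     invFun := modFun t⁻¹ p q
     left_inv := modFun_left t hp hq
     right_inv := fun x => by
       have := modFun_left t⁻¹ (fix_inv t hp) (fix_inv t hq) x
       rwa [inv_inv] at this },
   modFun_cont t hpq hp hq, modFun_cont t⁻¹ hpq (fix_inv t hp) (fix_inv t hq),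
   modFun_co t hp hq⟩

lemma ap_modHomeo (t : ↥HomeoPos) {p q : S1} (hpq : p ≠ q)
    (hp : ap t p = p) (hq : ap t q = q) (x : S1) :
    ap (modHomeo t hpq hp hq) x = modFun t p q x := rfl

end modify

lemma not_realization (σ : Fin 2 → ↥HomeoPos) (i : Fin 2) (x₀ : S1)
    (c : FreeGroup (Fin 2) → FreeGroup (Fin 2) → FreeGroup (Fin 2) → ℤ)
    (p q z : S1) (hp : ap (σ i) p = p) (hq : ap (σ i) q = q)
    (hz : circOrd p z q = 1) (hz' : ap (σ i) z ≠ z)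
    (hpc : p ∈ closure (Set.range fun g => ap (FreeGroup.lift σ g) x₀))
    (hqc : q ∈ closure (Set.range fun g => ap (FreeGroup.lift σ g) x₀))
    (hmiss : ∀ g, ¬ circOrd p (ap (FreeGroup.lift σ g) x₀) q = 1) :
    ¬ IsDynamicalRealization (FreeGroup.lift σ) x₀ c := by
  rintro ⟨hts, hind, hmax⟩
  have hpq : p ≠ q := (co_ne hz).2.2
  set τ : Fin 2 → ↥HomeoPos := Function.update σ i (modHomeo (σ i) hpq hp hq) with hτ
  have hof : ∀ j x, ¬ circOrd p x q = 1 → ap (τ j) x = ap (σ j) x := by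
    intro j x hx
    by_cases hj : j = i
    · subst hj
      simp [hτ, ap_modHomeo, modFun, hx]
    · simp [hτ, hj]
  have hagree : ∀ g h, ap (FreeGroup.lift τ g) (ap (FreeGroup.lift σ h) x₀) =
      ap (FreeGroup.lift σ (g * h)) x₀ := by
    intro g
    induction g using FreeGroup.induction_on with
    | C1 => intro h; simp [ap_one]
    | of j =>
      intro h
      rw [FreeGroup.lift_apply_of, hof _ _ (hmiss h), map_mul, ap_mul, FreeGroup.lift_apply_of]
    | inv_of j ih =>
      intro h
      have := ih ((FreeGroup.of j)⁻¹ * h)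
      rw [mul_inv_cancel_left] at this
      rw [← this, map_inv, ap_inv_ap]
    | mul g1 g2 h1 h2 =>
      intro h
      rw [map_mul, ap_mul, h2, h1, mul_assoc]
  have hag : ∀ g, ap (FreeGroup.lift τ g) x₀ = ap (FreeGroup.lift σ g) x₀ := by
    intro g
    have := hagree g 1
    simpa [ap_one] using this
  obtain ⟨f, ⟨hfc, hfs, hfo⟩, hf0, hfe⟩ := hmax (FreeGroup.lift τ)
    (fun g hg => hts g (by rw [← hag]; exact hg))
    (fun g₁ g₂ g₃ => by
      rw [← hind]; simp only [inducedCO, hag])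
  have hfix : ∀ x ∈ closure (Set.range fun g => ap (FreeGroup.lift σ g) x₀), f x = x := by
    intro x hx
    have hcl : IsClosed {x | f x = x} := isClosed_eq hfc continuous_id
    refine closure_minimal ?_ hcl hx
    rintro _ ⟨g, rfl⟩
    have := congrFun (hfe g) x₀
    simp only [Function.comp, hf0, hag] at this
    exact this.symm
  have hfp := hfix p hpc
  have hfq := hfix q hqc
  obtain ⟨y, hy⟩ := hfs z
  have hyJ : circOrd p y q = 1 := by
    have hh := co_ne hz
    rw [← hfo p y q (by rw [hfp, hy]; exact hh.1) (by rw [hfq, hy]; exact hh.2.1)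
      (by rw [hfp, hfq]; exact hh.2.2), hfp, hfq, hy]
    exact hz
  have := congrFun (hfe (FreeGroup.of i)) y
  simp only [Function.comp, FreeGroup.lift_apply_of, hy] at this
  apply hz'
  rw [this]
  simp [hτ, ap_modHomeo, modFun, hyJ, hy]

/-- letter action -/
def act (σ : Fin 2 → ↥HomeoPos) (s : Fin 2 × Bool) : ↥HomeoPos := cond s.2 (σ s.1) (σ s.1)⁻¹

lemma lift_cons (σ : Fin 2 → ↥HomeoPos) (s : Fin 2 × Bool) (t : List (Fin 2 × Bool)) :
    FreeGroup.lift σ (FreeGroup.mk (s :: t)) = act σ s * FreeGroup.lift σ (FreeGroup.mk t) := by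
  simp [FreeGroup.lift_mk, act]

lemma pingpong (σ : Fin 2 → ↥HomeoPos) (X : Fin 2 × Bool → Set S1) (J : Fin 2 → Set S1)
    (hd : ∀ s s', s ≠ s' → Disjoint (X s) (X s'))
    (hpp : ∀ (s : Fin 2 × Bool) y, y ∉ X (s.1, !s.2) → ap (act σ s) y ∈ X s)
    (hinv : ∀ (s : Fin 2 × Bool) y, ap (act σ s) y ∈ J s.1 ↔ y ∈ J s.1)
    (hJX : ∀ (s : Fin 2 × Bool) i, i ≠ s.1 → Disjoint (J i) (X s))
    (hJ : Disjoint (J 0) (J 1)) (y : S1) (hy : y ∈ J 0) (L : List (Fin 2 × Bool))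
    (hL : FreeGroup.IsReduced L) :
    ap (FreeGroup.lift σ (FreeGroup.mk L)) y ∉ J 1 ∧
      (ap (FreeGroup.lift σ (FreeGroup.mk L)) y ∈ J 0 ∨
        ∃ s t, L = s :: t ∧ ap (FreeGroup.lift σ (FreeGroup.mk L)) y ∈ X s) := by
  induction L with
  | nil =>
    have : ap (FreeGroup.lift σ (FreeGroup.mk [])) y = y := by
      simp [FreeGroup.lift_mk, ap_one]
    rw [this]
    exact ⟨Set.disjoint_left.1 hJ hy, Or.inl hy⟩
  | cons s t ih =>
    have ht : FreeGroup.IsReduced t := hL.infix ⟨[s], [], by simp⟩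
    obtain ⟨h1, h2⟩ := ih ht
    rw [lift_cons, ap_mul]
    set w := ap (FreeGroup.lift σ (FreeGroup.mk t)) y with hw
    have key : ap (act σ s) w ∈ J 0 ∨ ap (act σ s) w ∈ X s := by
      rcases h2 with h2 | ⟨s', t', rfl, h2⟩
      · by_cases hs : s.1 = 0
        · left
          have := (hinv s w).2 (by rwa [hs])
          rwa [hs] at this
        · right
          exact hpp s w (Set.disjoint_left.1 (hJX (s.1, !s.2) 0 (fun h => hs h.symm)) h2)
      · right
        apply hpp
        refine Set.disjoint_left.1 (hd _ _ ?_) h2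
        rintro rfl
        have := (List.isChain_cons_cons.1 hL).1 rfl
        simp at this
    refine ⟨?_, ?_⟩
    · rcases key with key | key
      · exact Set.disjoint_left.1 hJ key
      · by_cases hs : s.1 = 1
        · intro h
          apply h1
          have := (hinv s w).1 (by rwa [hs])
          rwa [hs] at this
        · exact fun h => Set.disjoint_left.1 (hJX s 1 (fun h => hs h.symm)) h key
    · rcases key with key | key
      · exact Or.inl key
      · exact Or.inr ⟨s, t, rfl, key⟩

lemma closure_sub (σ : Fin 2 → ↥HomeoPos) (x₀ : S1) (g u : FreeGroup (Fin 2)) (t : ↥HomeoPos)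
    (ht : FreeGroup.lift σ u = t) (p : S1)
    (hp : p ∈ closure (Set.range fun n : ℕ => ap (t ^ n) (ap (FreeGroup.lift σ g) x₀))) :
    p ∈ closure (Set.range fun g => ap (FreeGroup.lift σ g) x₀) := by
  refine closure_mono ?_ hp
  rintro _ ⟨n, rfl⟩
  exact ⟨u ^ n * g, by simp only [map_mul, map_pow, ht, ap_mul]⟩

/-- **Non-example.**  If `a, b ∈ Homeo₊(S¹)` have ping-pong dynamics with connected closed
attracting domains in the counterclockwise cyclic order `D(a), D(a⁻¹), D(b), D(b⁻¹)`, then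
the corresponding action of `F₂` is not the dynamical realization of any circular order
with any basepoint. -/
theorem separated_domains_not_dynamical_realization (a b : ↥HomeoPos)
    (Da Da' Db Db' : Set S1)
    (hne : Da.Nonempty ∧ Da'.Nonempty ∧ Db.Nonempty ∧ Db'.Nonempty)
    (hcl : IsClosed Da ∧ IsClosed Da' ∧ IsClosed Db ∧ IsClosed Db')
    (hconn : IsConnected Da ∧ IsConnected Da' ∧ IsConnected Db ∧ IsConnected Db')
    (hdisj : Disjoint Da Da' ∧ Disjoint Da Db ∧ Disjoint Da Db' ∧
      Disjoint Da' Db ∧ Disjoint Da' Db' ∧ Disjoint Db Db')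
    (hppa : (ap a) '' (Set.univ \ Da') ⊆ Da ∧ (ap a⁻¹) '' (Set.univ \ Da) ⊆ Da')
    (hppb : (ap b) '' (Set.univ \ Db') ⊆ Db ∧ (ap b⁻¹) '' (Set.univ \ Db) ⊆ Db')
    (horder : ∀ p ∈ Da, ∀ q ∈ Da', ∀ r ∈ Db, ∀ s ∈ Db',
      circOrd p q r = 1 ∧ circOrd p r s = 1) :
    ∀ (x₀ : S1) (c : FreeGroup (Fin 2) → FreeGroup (Fin 2) → FreeGroup (Fin 2) → ℤ),
      IsCircularOrder c →
      ¬ IsDynamicalRealization (FreeGroup.lift ![a, b]) x₀ c := by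
  intro x₀ c _
  obtain ⟨hneA, hneA', hneB, hneB'⟩ := hne
  obtain ⟨hcA, hcA', hcB, hcB'⟩ := hcl
  obtain ⟨d1, d2, d3, d4, d5, d6⟩ := hdisj
  set σ : Fin 2 → ↥HomeoPos := ![a, b] with hσ
  have e0 : FreeGroup.lift σ (FreeGroup.of 0) = a := by simp [hσ]
  have e1 : FreeGroup.lift σ (FreeGroup.of 1) = b := by simp [hσ]
  have e0' : FreeGroup.lift σ (FreeGroup.of 0)⁻¹ = a⁻¹ := by simp [hσ]
  have e1' : FreeGroup.lift σ (FreeGroup.of 1)⁻¹ = b⁻¹ := by simp [hσ]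
  -- order consequences
  have oA : ∀ o ∈ Db ∪ Db', ∀ p ∈ Da, ∀ q ∈ Da', circOrd p q o = 1 := by
    intro o ho p hp q hq
    rcases ho with ho | ho
    · obtain ⟨s, hs⟩ := hneB'
      exact (horder p hp q hq o ho s hs).1
    · obtain ⟨r, hr⟩ := hneB
      have := horder p hp q hq r hr o ho
      exact (co_trans this.1 this.2).1
  have oB : ∀ o ∈ Da ∪ Da', ∀ p ∈ Db, ∀ q ∈ Db', circOrd p q o = 1 := by
    intro o ho p hp q hq
    rcases ho with ho | ho
    · obtain ⟨s, hs⟩ := hneA'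
      rw [← co_rot]
      exact (horder o ho s hs p hp q hq).2
    · obtain ⟨r, hr⟩ := hneA
      have := horder r hr o ho p hp q hq
      rw [← co_rot]
      exact (co_trans this.1 this.2).2
  obtain ⟨g, hg⟩ : ∃ g, ap (FreeGroup.lift σ g) x₀ ∈ Db ∪ Db' := by
    by_cases h : x₀ ∈ Db'
    · exact ⟨1, by right; simpa [ap_one] using h⟩
    · exact ⟨FreeGroup.of 1, by left; rw [e1]; exact hppb.1 ⟨x₀, ⟨trivial, h⟩, rfl⟩⟩
  obtain ⟨g', hg'⟩ : ∃ g, ap (FreeGroup.lift σ g) x₀ ∈ Da ∪ Da' := by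
    by_cases h : x₀ ∈ Da'
    · exact ⟨1, by right; simpa [ap_one] using h⟩
    · exact ⟨FreeGroup.of 0, by left; rw [e0]; exact hppa.1 ⟨x₀, ⟨trivial, h⟩, rfl⟩⟩
  obtain ⟨p, hp, q, hq, hfp, hfq, hpc, hqc⟩ :=
    exists_fix a Da Da' hcA hcA' hneA hneA' d1 hppa _ (oA _ hg)
  obtain ⟨p', hp', q', hq', hfp', hfq', hpc', hqc'⟩ :=
    exists_fix b Db Db' hcB hcB' hneB hneB' d6 hppb _ (oB _ hg')
  obtain ⟨z, hz, hzm⟩ := exists_moved a Da Da' hcA hcA' d1 hppa.1 p q hp hq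
  obtain ⟨z', hz', hzm'⟩ := exists_moved b Db Db' hcB hcB' d6 hppb.1 p' q' hp' hq'
  by_cases hm : ∀ g, ¬ circOrd p (ap (FreeGroup.lift σ g) x₀) q = 1
  · exact not_realization σ 0 x₀ c p q z hfp hfq hz hzm
      (closure_sub σ x₀ g _ _ e0 p hpc) (closure_sub σ x₀ g _ _ e0' q hqc) hm
  by_cases hm' : ∀ g, ¬ circOrd p' (ap (FreeGroup.lift σ g) x₀) q' = 1
  · exact not_realization σ 1 x₀ c p' q' z' hfp' hfq' hz' hzm'
      (closure_sub σ x₀ g' _ _ e1 p' hpc') (closure_sub σ x₀ g' _ _ e1' q' hqc') hm'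
  exfalso
  push Not at hm hm'
  obtain ⟨u, hu⟩ := hm
  obtain ⟨v, hv⟩ := hm'
  let X : Fin 2 × Bool → Set S1 := fun s =>
    if s.1 = 0 then (if s.2 = true then Da else Da') else (if s.2 = true then Db else Db')
  let J : Fin 2 → Set S1 := fun i =>
    if i = 0 then {w | circOrd p w q = 1} else {w | circOrd p' w q' = 1}
  have hJA : ∀ w, circOrd p w q = 1 → w ∉ Db ∪ Db' := by
    intro w hw h
    have := oA w h p hp q hq
    simp only [co_iff, Cyc] at *; grind
  have hJB : ∀ w, circOrd p' w q' = 1 → w ∉ Da ∪ Da' := by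
    intro w hw h
    have := oB w h p' hp' q' hq'
    simp only [co_iff, Cyc] at *; grind
  have hdis : ∀ s s', s ≠ s' → Disjoint (X s) (X s') := by
    rintro ⟨i, x⟩ ⟨j, y⟩ h
    fin_cases i <;> fin_cases j <;> cases x <;> cases y <;>
      first
      | exact absurd rfl h
      | (simp [X]; first | assumption | (apply Disjoint.symm; assumption))
  have hP : ∀ (s : Fin 2 × Bool) y, y ∉ X (s.1, !s.2) → ap (act σ s) y ∈ X s := by
    rintro ⟨i, x⟩ y h
    fin_cases i <;> cases x <;> simp [X, act, hσ] at h ⊢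
    · exact hppa.2 ⟨y, ⟨trivial, h⟩, rfl⟩
    · exact hppa.1 ⟨y, ⟨trivial, h⟩, rfl⟩
    · exact hppb.2 ⟨y, ⟨trivial, h⟩, rfl⟩
    · exact hppb.1 ⟨y, ⟨trivial, h⟩, rfl⟩
  have hinv : ∀ (s : Fin 2 × Bool) y, ap (act σ s) y ∈ J s.1 ↔ y ∈ J s.1 := by
    rintro ⟨i, x⟩ y
    fin_cases i <;> cases x <;> simp [J, act, hσ]
    · rw [arc_inv _ (fix_inv a hfp) (fix_inv a hfq)]
    · rw [arc_inv _ hfp hfq]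
    · rw [arc_inv _ (fix_inv b hfp') (fix_inv b hfq')]
    · rw [arc_inv _ hfp' hfq']
  have hJX : ∀ (s : Fin 2 × Bool) i, i ≠ s.1 → Disjoint (J i) (X s) := by
    rintro ⟨j, x⟩ i h
    rw [Set.disjoint_left]
    intro w hw hw'
    fin_cases i <;> fin_cases j <;> cases x <;> simp [X, J] at h hw hw'
    · exact hJA w hw (Or.inr hw')
    · exact hJA w hw (Or.inl hw')
    · exact hJB w hw (Or.inr hw')
    · exact hJB w hw (Or.inl hw')
  have hJ : Disjoint (J 0) (J 1) := by
    rw [Set.disjoint_left]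
    intro w hw hw'
    simp [J] at hw hw'
    have := horder p hp q hq p' hp' q' hq'
    simp only [co_iff, Cyc] at *; grind
  have := (pingpong σ X J hdis hP hinv hJX hJ (ap (FreeGroup.lift σ u) x₀) (by simpa [J] using hu)
    (v * u⁻¹).toWord FreeGroup.isReduced_toWord).1
  rw [FreeGroup.mk_toWord, ← ap_mul, ← map_mul, inv_mul_cancel_right] at this
  exact this (by simpa [J] using hv)
end
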